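/- Every finite simple graph G with no triangle adjacent to a 4-cycle satisfies α(G) ≥ |V(G)| − (19·|V(G)| + 3·|E(G)| + 3·λ(G))/34. -/

import Mathlib

namespace Paper

/-- `s` is an independent set in the simple graph `G`. -/
def IsIndepSet {V : Type} (G : SimpleGraph V) (s : Finset V) : Prop :=
  ∀ v ∈ s, ∀ w ∈ s, ¬ G.Adj v w

/-- The independence number `α(G)`: the size of a largest independent set. -/
noncomputable def indepNum {V : Type} (G : SimpleGraph V) : ℕ :=
  sSup {n | ∃ s : Finset V, IsIndepSet G s ∧ s.card = n}

/-- The number of edges `|E(G)|`. -/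
noncomputable def numEdges {V : Type} (G : SimpleGraph V) : ℕ :=
  Nat.card G.edgeSet

/-- The degree of a vertex. -/
noncomputable def deg {V : Type} (G : SimpleGraph V) (v : V) : ℕ :=
  Nat.card (G.neighborSet v)

/-- `G` contains a triangle sharing a common edge with a 4-cycle:
the triangle `u v w` and the 4-cycle `u v x y` share the edge `u v`. -/
def HasTriangleAdjC4 {V : Type} (G : SimpleGraph V) : Prop :=
  ∃ u v w x y : V, G.Adj u v ∧ G.Adj v w ∧ G.Adj w u ∧
    G.Adj v x ∧ G.Adj x y ∧ G.Adj y u ∧ u ≠ x ∧ v ≠ y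

/-- `G` contains two triangles sharing a common edge:
the triangles `u v w` and `u v x` share the edge `u v`. -/
def HasAdjTriangles {V : Type} (G : SimpleGraph V) : Prop :=
  ∃ u v w x : V, G.Adj u v ∧ G.Adj v w ∧ G.Adj w u ∧
    G.Adj v x ∧ G.Adj x u ∧ w ≠ x

/-- `G` contains a triangle sharing a common edge with a 5-cycle:
the triangle `u v w` and the 5-cycle `u v x y z` share the edge `u v`. -/
def HasTriangleAdjC5 {V : Type} (G : SimpleGraph V) : Prop :=
  ∃ u v w x y z : V, G.Adj u v ∧ G.Adj v w ∧ G.Adj w u ∧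
    G.Adj v x ∧ G.Adj x y ∧ G.Adj y z ∧ G.Adj z u ∧
    u ≠ x ∧ u ≠ y ∧ v ≠ y ∧ v ≠ z ∧ x ≠ z

/-- The 2-chain of triangles: two disjoint triangles `{0,1,2}` and `{3,4,5}`
joined by the single edge `{2,3}` (6 vertices, 7 edges). -/
def chainGraph : SimpleGraph (Fin 6) :=
  SimpleGraph.fromRel (fun i j =>
    (i.val, j.val) ∈ [(0,1), (0,2), (1,2), (3,4), (3,5), (4,5), (2,3)])

/-- A connected component is difficult if it is a triangle or a 2-chain of triangles. -/
def IsDifficult {V : Type} (G : SimpleGraph V) (c : G.ConnectedComponent) : Prop :=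
  Nonempty (SimpleGraph.induce c.supp G ≃g (⊤ : SimpleGraph (Fin 3))) ∨
  Nonempty (SimpleGraph.induce c.supp G ≃g chainGraph)

/-- `λ(G)`: the number of difficult components of `G`. -/
noncomputable def lambda {V : Type} (G : SimpleGraph V) : ℕ :=
  Nat.card {c : G.ConnectedComponent // IsDifficult G c}

/-- `Φ(S)`: the number of edges of `G` with exactly one endpoint in `S`. -/
noncomputable def phi {V : Type} (G : SimpleGraph V) (S : Set V) : ℕ :=
  Nat.card {e : Sym2 V | e ∈ G.edgeSet ∧ ∃ x ∈ S, ∃ y, y ∉ S ∧ e = s(x, y)}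

section Cut

open Finset

variable {V : Type} (G : SimpleGraph V) [DecidableRel G.Adj]

/-- The number of pairs `(a, b)` of adjacent vertices with `a ∈ A` and `b ∈ B`. -/
def cut (A B : Finset V) : ℕ := ∑ a ∈ A, ∑ b ∈ B, if G.Adj a b then 1 else 0

lemma cut_comm (A B : Finset V) : cut G A B = cut G B A := by
  unfold cut
  rw [sum_comm]
  simp only [G.adj_comm]

lemma cut_mono {A A' B B' : Finset V} (hA : A ⊆ A') (hB : B ⊆ B') :
    cut G A B ≤ cut G A' B' :=
  (sum_le_sum_of_subset hA).trans (sum_le_sum fun _ _ => sum_le_sum_of_subset hB)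

lemma cut_eq_zero_iff {A B : Finset V} :
    cut G A B = 0 ↔ ∀ a ∈ A, ∀ b ∈ B, ¬ G.Adj a b := by
  simp [cut, sum_eq_zero_iff]

lemma cut_eq_card (A B : Finset V) :
    cut G A B = #{p ∈ A ×ˢ B | G.Adj p.1 p.2} := by
  rw [card_filter, sum_product, cut]

lemma cut_eq_sum (A B : Finset V) : cut G A B = ∑ a ∈ A, cut G {a} B := by
  simp [cut]

lemma cut_singleton (v : V) (B : Finset V) : cut G {v} B = #{b ∈ B | G.Adj v b} := by
  simp [cut]

lemma cut_self_singleton (v : V) : cut G {v} {v} = 0 := by simp [cut]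

lemma cut_le_one {A B : Finset V}
    (h : ∀ a ∈ A, ∀ a' ∈ A, ∀ b ∈ B, ∀ b' ∈ B, G.Adj a b → G.Adj a' b' → a = a' ∧ b = b') :
    cut G A B ≤ 1 := by
  rw [cut_eq_card, card_le_one]
  simp only [mem_filter, mem_product, and_imp, Prod.forall, Prod.mk.injEq]
  intro a b ha hb hab a' b' ha' hb' hab'
  exact h a ha a' ha' b hb b' hb' hab hab'

variable {G} in
lemma card_mul_le_cut {A B : Finset V} {k : ℕ} (h : ∀ a ∈ A, k ≤ cut G {a} B) :
    #A * k ≤ cut G A B := by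
  rw [cut_eq_sum, ← smul_eq_mul]
  exact card_nsmul_le_sum _ _ _ h

variable {G} in
lemma cut_le_card_mul {A B : Finset V} {k : ℕ} (h : ∀ a ∈ A, cut G {a} B ≤ k) :
    cut G A B ≤ #A * k := by
  rw [cut_eq_sum, ← smul_eq_mul]
  exact sum_le_card_nsmul _ _ _ h

variable [DecidableEq V]

lemma cut_union_left {A B : Finset V} (h : Disjoint A B) (C : Finset V) :
    cut G (A ∪ B) C = cut G A C + cut G B C := sum_union h

lemma cut_union_right {B C : Finset V} (h : Disjoint B C) (A : Finset V) :
    cut G A (B ∪ C) = cut G A B + cut G A C := by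
  rw [cut_comm, cut_union_left G h, cut_comm G B, cut_comm G C]

lemma cut_sdiff_right {B C : Finset V} (h : B ⊆ C) (A : Finset V) :
    cut G A C = cut G A B + cut G A (C \ B) := by
  rw [← cut_union_right G disjoint_sdiff, union_sdiff_of_subset h]

lemma even_cut_self (A : Finset V) : Even (cut G A A) := by
  induction A using Finset.induction_on with
  | empty => simp [cut]
  | insert a s ha ih =>
    have hd : Disjoint {a} s := by simpa using ha
    rw [insert_eq, cut_union_left G hd, cut_union_right G hd, cut_union_right G hd,
      cut_self_singleton, cut_comm G s {a}]
    obtain ⟨k, hk⟩ := ih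
    exact ⟨cut G {a} s + k, by omega⟩

lemma cut_self_add {S W : Finset V} (h : S ⊆ W) :
    cut G W W + cut G S S = cut G (W \ S) (W \ S) + 2 * cut G S W := by
  have e : W = S ∪ (W \ S) := (union_sdiff_of_subset h).symm
  have h1 : cut G W W = cut G S W + cut G (W \ S) W := by
    conv_lhs => rw [e, cut_union_left G disjoint_sdiff, ← e]
  have h2 := cut_sdiff_right G h S
  have h3 := cut_sdiff_right G h (W \ S)
  rw [cut_comm G (W \ S) S] at h3
  omega

end Cut

section Difficult

open Finset

variable {V : Type} [DecidableEq V] (G : SimpleGraph V)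

/-- `T` is the vertex set of a triangle. -/
def IsTriangle (T : Finset V) : Prop :=
  ∃ a b c, G.Adj a b ∧ G.Adj b c ∧ G.Adj a c ∧ T = {a, b, c}

/-- `C` is the union of two disjoint triangles with an edge between them. -/
def IsChain (C : Finset V) : Prop :=
  ∃ A B, IsTriangle G A ∧ IsTriangle G B ∧ Disjoint A B ∧
    (∃ x ∈ A, ∃ y ∈ B, G.Adj x y) ∧ C = A ∪ B

/-- `C` spans a triangle or a 2-chain of triangles. -/
def IsDifficultSet (C : Finset V) : Prop := IsTriangle G C ∨ IsChain G C

/-- No edge of `G` joins `A` to a vertex of `W` outside `A`. -/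
def IsClosedIn (A W : Finset V) : Prop := ∀ x ∈ A, ∀ y ∈ W, G.Adj x y → y ∈ A

variable {G}

lemma IsTriangle.card {T : Finset V} (h : IsTriangle G T) : #T = 3 := by
  obtain ⟨a, b, c, hab, hbc, hac, rfl⟩ := h
  exact card_eq_three.2 ⟨a, b, c, hab.ne, hac.ne, hbc.ne, rfl⟩

lemma IsTriangle.adj {T : Finset V} (h : IsTriangle G T) {x y : V} (hx : x ∈ T) (hy : y ∈ T)
    (hxy : x ≠ y) : G.Adj x y := by
  obtain ⟨a, b, c, hab, hbc, hac, rfl⟩ := h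
  simp only [mem_insert, mem_singleton] at hx hy
  have := hab.symm
  have := hbc.symm
  have := hac.symm
  rcases hx with rfl | rfl | rfl <;> rcases hy with rfl | rfl | rfl <;> first | assumption | simp_all

lemma IsTriangle.exists_third {T : Finset V} (h : IsTriangle G T) (x y : V) :
    ∃ z ∈ T, z ≠ x ∧ z ≠ y := by
  have h1 : #({x, y} : Finset V) < #T := by
    rw [h.card]
    exact (card_le_two).trans_lt (by norm_num)
  obtain ⟨z, hz, hz'⟩ := exists_mem_notMem_of_card_lt_card h1
  simp only [mem_insert, mem_singleton, not_or] at hz'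
  exact ⟨z, hz, hz'⟩

lemma IsChain.card {C : Finset V} (h : IsChain G C) : #C = 6 := by
  obtain ⟨A, B, hA, hB, hd, -, rfl⟩ := h
  rw [card_union_of_disjoint hd, hA.card, hB.card]

lemma eq_of_adj_triangles (hG : ¬ HasTriangleAdjC4 G) {u v w x : V} (huv : G.Adj u v)
    (huw : G.Adj u w) (hvw : G.Adj v w) (hux : G.Adj u x) (hvx : G.Adj v x) : w = x := by
  by_contra hne
  exact hG ⟨u, w, v, v, x, huw, hvw.symm, huv.symm, hvw.symm, hvx, hux.symm, huv.ne, hne⟩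

lemma triangle_edges_unique (hG : ¬ HasTriangleAdjC4 G) {A B : Finset V} (hA : IsTriangle G A)
    (hB : IsTriangle G B) (hd : Disjoint A B) {a a' b b' : V} (ha : a ∈ A) (ha' : a' ∈ A)
    (hb : b ∈ B) (hb' : b' ∈ B) (h : G.Adj a b) (h' : G.Adj a' b') : a = a' ∧ b = b' := by
  have hne : ∀ {x y}, x ∈ A → y ∈ B → x ≠ y := fun hx hy => disjoint_iff_ne.1 hd _ hx _ hy
  by_cases h1 : a = a'
  · subst h1
    refine ⟨rfl, ?_⟩
    by_contra h2
    obtain ⟨z, hz, hzb, hzb'⟩ := hB.exists_third b b'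
    exact hne ha hz (eq_of_adj_triangles hG (hB.adj hb hb' h2) h.symm h'.symm
      (hB.adj hb hz hzb.symm) (hB.adj hb' hz hzb'.symm))
  · exfalso
    obtain ⟨z, hz, hza, hza'⟩ := hA.exists_third a a'
    by_cases h2 : b = b'
    · subst h2
      exact hne hz hb (eq_of_adj_triangles hG (hA.adj ha ha' h1)
        (hA.adj ha hz hza.symm) (hA.adj ha' hz hza'.symm) h h')
    · exact hG ⟨a, a', z, b', b, hA.adj ha ha' h1, hA.adj ha' hz hza'.symm, hA.adj hz ha hza, h',
        hB.adj hb' hb (Ne.symm h2), h.symm, hne ha hb', hne ha' hb⟩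

lemma IsDifficultSet.card {C : Finset V} (h : IsDifficultSet G C) : #C = 3 ∨ #C = 6 :=
  h.imp (·.card) (·.card)

lemma IsDifficultSet.nonempty {C : Finset V} (h : IsDifficultSet G C) : C.Nonempty := by
  rw [← card_pos]
  have := h.card
  omega

lemma IsDifficultSet.isTriangle {C : Finset V} (h : IsDifficultSet G C) (hC : #C = 3) :
    IsTriangle G C :=
  h.resolve_right fun h' => by have := h'.card; omega

lemma IsTriangle.subset_of_isClosedIn {T A W : Finset V} (hT : IsTriangle G T) (hTW : T ⊆ W)
    (hA : IsClosedIn G A W) {x : V} (hxT : x ∈ T) (hxA : x ∈ A) : T ⊆ A := by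
  intro y hy
  by_cases h : x = y
  · exact h ▸ hxA
  · exact hA x hxA y (hTW hy) (hT.adj hxT hy h)

lemma IsDifficultSet.subset_of_isClosedIn {C A W : Finset V} (hC : IsDifficultSet G C)
    (hCW : C ⊆ W) (hA : IsClosedIn G A W) {x : V} (hxC : x ∈ C) (hxA : x ∈ A) : C ⊆ A := by
  rcases hC with hC | ⟨X, Y, hX, hY, hd, ⟨p, hp, q, hq, hpq⟩, rfl⟩
  · exact hC.subset_of_isClosedIn hCW hA hxC hxA
  · have hXW := subset_union_left.trans hCW
    have hYW := subset_union_right.trans hCW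
    rcases mem_union.1 hxC with h | h
    · have h1 := hX.subset_of_isClosedIn hXW hA h hxA
      exact union_subset h1 (hY.subset_of_isClosedIn hYW hA hq (hA p (h1 hp) q (hYW hq) hpq))
    · have h1 := hY.subset_of_isClosedIn hYW hA h hxA
      exact union_subset (hX.subset_of_isClosedIn hXW hA hp
        (hA q (h1 hq) p (hXW hp) hpq.symm)) h1

lemma IsDifficultSet.eq_of_isClosedIn {C C' W : Finset V} (hC : IsDifficultSet G C)
    (hC' : IsDifficultSet G C') (hCW : C ⊆ W) (hCW' : C' ⊆ W) (h : IsClosedIn G C W)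
    (h' : IsClosedIn G C' W) {x : V} (hx : x ∈ C) (hx' : x ∈ C') : C = C' :=
  (hC.subset_of_isClosedIn hCW h' hx hx').antisymm (hC'.subset_of_isClosedIn hCW' h hx' hx)

lemma indepSet_pair {x y : V} (h : ¬ G.Adj x y) : IsIndepSet G {x, y} := by
  intro v hv w hw
  simp only [mem_insert, mem_singleton] at hv hw
  rcases hv with rfl | rfl <;> rcases hw with rfl | rfl <;>
    first | exact G.irrefl | assumption | exact fun h' => h h'.symm

/-- A triangle or 2-chain has a maximum independent set avoiding two prescribed vertices. -/
lemma IsDifficultSet.exists_indepSet (hG : ¬ HasTriangleAdjC4 G) {C B : Finset V}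
    (hC : IsDifficultSet G C) (hB : #B ≤ 2) :
    ∃ I ⊆ C \ B, IsIndepSet G I ∧ 3 * #I = #C := by
  obtain ⟨u, v, hBuv⟩ : ∃ u v, B ⊆ {u, v} := by
    rcases Finset.eq_empty_or_nonempty B with rfl | ⟨u, hu⟩
    · obtain ⟨x, -⟩ := hC.nonempty
      exact ⟨x, x, empty_subset _⟩
    · have h1 : #(B.erase u) ≤ 1 := by rw [card_erase_of_mem hu]; omega
      rcases Finset.eq_empty_or_nonempty (B.erase u) with h2 | ⟨v, hv⟩
      · refine ⟨u, u, fun x hx => ?_⟩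
        by_contra hxu
        exact notMem_empty x (h2 ▸ mem_erase.2 ⟨by simpa using hxu, hx⟩)
      · refine ⟨u, v, fun x hx => ?_⟩
        by_cases hxu : x = u
        · simp [hxu]
        · simp [card_le_one.1 h1 x (mem_erase.2 ⟨hxu, hx⟩) v hv]
  have hav : ∀ {z}, z ≠ u → z ≠ v → z ∉ B := fun h1 h2 hz => by
    have := hBuv hz
    simp_all
  rcases hC with hC | hC
  · obtain ⟨z, hz, hzu, hzv⟩ := hC.exists_third u v
    refine ⟨{z}, by simp [hz, hav hzu hzv], ?_, by simp [hC.card]⟩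
    intro x hx y hy
    rw [mem_singleton.1 hx, mem_singleton.1 hy]
    exact G.irrefl
  · have hcard := hC.card
    obtain ⟨X, Y, hX, hY, hd, -, rfl⟩ := hC
    have hne : ∀ {x y}, x ∈ X → y ∈ Y → x ≠ y := fun hx hy => disjoint_iff_ne.1 hd _ hx _ hy
    have key : ∀ p ∈ X, ∀ q ∈ Y, p ∉ B → q ∉ B → ¬ G.Adj p q →
        ∃ I ⊆ (X ∪ Y) \ B, IsIndepSet G I ∧ 3 * #I = #(X ∪ Y) := by
      intro p hp q hq hpB hqB hpq
      refine ⟨{p, q}, ?_, indepSet_pair hpq, by rw [card_pair (hne hp hq), hcard]⟩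
      simp [insert_subset_iff, *]
    obtain ⟨p, hp, hpu, hpv⟩ := hX.exists_third u v
    obtain ⟨q, hq, hqu, hqv⟩ := hY.exists_third u v
    by_cases hpq : G.Adj p q
    · obtain ⟨p', hp', hp'p, hp'u⟩ := hX.exists_third p u
      obtain ⟨q', hq', hq'q, hq'u⟩ := hY.exists_third q u
      have hn1 : ¬ G.Adj p q' := fun h =>
        hq'q (triangle_edges_unique hG hX hY hd hp hp hq' hq h hpq).2
      have hn2 : ¬ G.Adj p' q := fun h =>
        hp'p (triangle_edges_unique hG hX hY hd hp' hp hq hq h hpq).1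
      by_cases h1 : q' = v
      · have h2 : p' ≠ v := fun h => hne hp' hq' (h.trans h1.symm)
        exact key p' hp' q hq (hav hp'u h2) (hav hqu hqv) hn2
      · exact key p hp q' hq' (hav hpu hpv) (hav hq'u h1) hn1
    · exact key p hp q hq (hav hpu hpv) (hav hqu hqv) hpq

/-- Vertices attached to distinct vertices of a triangle are distinct and nonadjacent. -/
lemma IsTriangle.pendants (hG : ¬ HasTriangleAdjC4 G) {T : Finset V}
    (hT : IsTriangle G T) {x y x' y' : V} (hx : x ∈ T) (hy : y ∈ T) (hxy : x ≠ y)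
    (hx' : x' ∉ T) (hy' : y' ∉ T) (hxx' : G.Adj x x') (hyy' : G.Adj y y') :
    ¬ G.Adj x y' ∧ x' ≠ y' ∧ ¬ G.Adj x' y' := by
  obtain ⟨z, hz, hzx, hzy⟩ := hT.exists_third x y
  have h1 : ¬ G.Adj x y' := fun h => hy' (eq_of_adj_triangles hG (hT.adj hx hy hxy)
    (hT.adj hx hz hzx.symm) (hT.adj hy hz hzy.symm) h hyy' ▸ hz)
  refine ⟨h1, fun h => h1 (h ▸ hxx'), fun h => ?_⟩
  exact hG ⟨x, y, z, y', x', hT.adj hx hy hxy, hT.adj hy hz hzy.symm, hT.adj hz hx hzx,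
    hyy', h.symm, hxx'.symm, fun h => hy' (h ▸ hx), fun h => hx' (h ▸ hy)⟩

variable [DecidableRel G.Adj]

lemma IsTriangle.cut_self {T : Finset V} (hT : IsTriangle G T) : cut G T T = 6 := by
  have h : ∀ a ∈ T, cut G {a} T = 2 := by
    intro a ha
    rw [cut_singleton]
    have : {b ∈ T | G.Adj a b} = T.erase a := by
      ext b
      simp only [mem_filter, mem_erase]
      exact ⟨fun h => ⟨h.2.ne', h.1⟩, fun h => ⟨h.2, hT.adj ha h.2 h.1.symm⟩⟩
    rw [this, card_erase_of_mem ha, hT.card]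
  rw [cut_eq_sum, sum_congr rfl h, sum_const, hT.card]
  rfl

lemma cut_triangles_le_one (hG : ¬ HasTriangleAdjC4 G) {A B : Finset V} (hA : IsTriangle G A)
    (hB : IsTriangle G B) (hd : Disjoint A B) : cut G A B ≤ 1 :=
  cut_le_one G fun _ ha _ ha' _ hb _ hb' h h' =>
    triangle_edges_unique hG hA hB hd ha ha' hb hb' h h'

lemma cut_vertex_triangle_le_one (hG : ¬ HasTriangleAdjC4 G) {T : Finset V} (hT : IsTriangle G T)
    {v : V} (hv : v ∉ T) : cut G {v} T ≤ 1 := by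
  refine cut_le_one G fun a ha a' ha' b hb b' hb' h h' => ?_
  rw [mem_singleton] at ha ha'
  subst ha ha'
  refine ⟨rfl, ?_⟩
  by_contra h2
  obtain ⟨z, hz, hzb, hzb'⟩ := hT.exists_third b b'
  exact hv (eq_of_adj_triangles hG (hT.adj hb hb' h2) (hT.adj hb hz hzb.symm)
      (hT.adj hb' hz hzb'.symm) h.symm h'.symm ▸ hz)

lemma IsChain.cut_self (hG : ¬ HasTriangleAdjC4 G) {C : Finset V} (hC : IsChain G C) :
    cut G C C = 14 := by
  obtain ⟨A, B, hA, hB, hd, ⟨x, hx, y, hy, hxy⟩, rfl⟩ := hC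
  have h1 := cut_triangles_le_one hG hA hB hd
  have h2 : cut G A B ≠ 0 := fun h => (cut_eq_zero_iff G).1 h x hx y hy hxy
  rw [cut_union_left G hd, cut_union_right G hd, cut_union_right G hd, hA.cut_self, hB.cut_self,
    cut_comm G B A]
  omega

lemma cut_vertex_difficult_le_two (hG : ¬ HasTriangleAdjC4 G) {C : Finset V}
    (hC : IsDifficultSet G C) {v : V} (hv : v ∉ C) : cut G {v} C ≤ 2 := by
  rcases hC with hC | ⟨A, B, hA, hB, hd, -, rfl⟩
  · exact (cut_vertex_triangle_le_one hG hC hv).trans one_le_two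
  · rw [mem_union, not_or] at hv
    rw [cut_union_right G hd]
    have := cut_vertex_triangle_le_one hG hA hv.1
    have := cut_vertex_triangle_le_one hG hB hv.2
    omega

end Difficult

section Potential

open Finset

variable {V : Type} {G : SimpleGraph V}

lemma IsClosedIn.trans {C A W : Finset V} (h : IsClosedIn G C A) (hCA : C ⊆ A)
    (hA : IsClosedIn G A W) : IsClosedIn G C W :=
  fun x hx y hy hxy => h x hx y (hA x (hCA hx) y hy hxy) hxy

variable [DecidableEq V]

open scoped Classical in
/-- The vertex sets of the difficult components of the subgraph induced by `W`. -/
noncomputable def difficultComps (G : SimpleGraph V) (W : Finset V) : Finset (Finset V) :=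
  {C ∈ W.powerset | IsDifficultSet G C ∧ IsClosedIn G C W}

/-- The total weight of the difficult components: triangles count `2`, 2-chains count `1`. -/
noncomputable def weight (G : SimpleGraph V) (W : Finset V) : ℕ :=
  ∑ C ∈ difficultComps G W, if #C = 3 then 2 else 1

lemma mem_difficultComps {C W : Finset V} :
    C ∈ difficultComps G W ↔ C ⊆ W ∧ IsDifficultSet G C ∧ IsClosedIn G C W := by
  simp [difficultComps]

lemma weight_le (W : Finset V) : weight G W ≤ 2 * #(difficultComps G W) := by
  rw [mul_comm, ← smul_eq_mul]
  refine sum_le_card_nsmul _ _ _ fun C _ => ?_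
  split_ifs <;> omega

lemma weight_le_card {W : Finset V} (h : ∀ C ∈ difficultComps G W, #C ≠ 3) :
    weight G W ≤ #(difficultComps G W) := by
  rw [← mul_one #_, ← smul_eq_mul]
  refine sum_le_card_nsmul _ _ _ fun C hC => ?_
  simp [h C hC]

lemma IsClosedIn.sdiff {A W : Finset V} (h : IsClosedIn G A W) :
    IsClosedIn G (W \ A) W := by
  intro x hx y hy hxy
  rw [mem_sdiff] at hx ⊢
  exact ⟨hy, fun hyA => hx.2 (h y hyA x hx.1 hxy.symm)⟩

lemma weight_add_le {A W : Finset V} (hAW : A ⊆ W) (hA : IsClosedIn G A W) :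
    weight G A + weight G (W \ A) ≤ weight G W := by
  unfold weight
  rw [← sum_union]
  · refine sum_le_sum_of_subset fun C hC => ?_
    simp only [mem_union, mem_difficultComps] at hC ⊢
    rcases hC with ⟨h1, h2, h3⟩ | ⟨h1, h2, h3⟩
    · exact ⟨h1.trans hAW, h2, h3.trans h1 hA⟩
    · exact ⟨h1.trans sdiff_subset, h2, h3.trans h1 hA.sdiff⟩
  · rw [disjoint_left]
    intro C h1 h2
    rw [mem_difficultComps] at h1 h2
    obtain ⟨x, hx⟩ := h1.2.1.nonempty
    exact (mem_sdiff.1 (h2.1 hx)).2 (h1.1 hx)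

lemma IsIndepSet.union {I J : Finset V} (hI : IsIndepSet G I) (hJ : IsIndepSet G J)
    (h : ∀ x ∈ I, ∀ y ∈ J, ¬ G.Adj x y) : IsIndepSet G (I ∪ J) := by
  intro x hx y hy hxy
  rcases mem_union.1 hx with hx | hx <;> rcases mem_union.1 hy with hy | hy
  · exact hI x hx y hy hxy
  · exact h x hx y hy hxy
  · exact h y hy x hx hxy.symm
  · exact hJ x hx y hy hxy

variable [DecidableRel G.Adj]

/-- The subgraph induced by `W` has an independent set of the required size. -/
def HasLargeIndepSet (G : SimpleGraph V) [DecidableRel G.Adj] (W : Finset V) : Prop :=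
  ∃ I ⊆ W, IsIndepSet G I ∧ 30 * #W ≤ 68 * #I + 3 * cut G W W + 2 * weight G W

/-- `W` is a minimal vertex set without a large independent set. -/
structure IsMinimalBad (G : SimpleGraph V) [DecidableRel G.Adj] (W : Finset V) : Prop where
  notLarge : ¬ HasLargeIndepSet G W
  large_of_ssubset : ∀ W' ⊂ W, HasLargeIndepSet G W'

namespace IsMinimalBad

variable {W : Finset V}

lemma reduction (hW : IsMinimalBad G W) {S I : Finset V} (hS : S ⊆ W) (hSne : S.Nonempty)
    (hI : I ⊆ S) (hIind : IsIndepSet G I) (hIS : ∀ x ∈ I, ∀ y ∈ W, G.Adj x y → y ∈ S) :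
    68 * #I + 6 * cut G S W < 30 * #S + 3 * cut G S S + 2 * weight G (W \ S) := by
  by_contra hcon
  obtain ⟨J, hJ, hJind, hJcard⟩ := hW.large_of_ssubset (W \ S) (sdiff_ssubset hS hSne)
  have hno : ∀ x ∈ I, ∀ y ∈ J, ¬ G.Adj x y := by
    intro x hx y hy hxy
    have hyS := mem_sdiff.1 (hJ hy)
    exact hyS.2 (hIS x hx y hyS.1 hxy)
  refine hW.notLarge ⟨I ∪ J, union_subset (hI.trans hS) (hJ.trans sdiff_subset),
    hIind.union hJind hno, ?_⟩
  have hd : Disjoint I J := disjoint_of_subset_left hI (disjoint_of_subset_right hJ disjoint_sdiff)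
  rw [card_union_of_disjoint hd]
  have h1 := cut_self_add G hS
  have h2 := card_sdiff_add_card_eq_card hS
  omega

lemma eq_of_isClosedIn (hW : IsMinimalBad G W) {A : Finset V} (hA : A ⊆ W) (hne : A.Nonempty)
    (hcl : IsClosedIn G A W) : A = W := by
  by_contra hAW
  obtain ⟨I, hI, hIind, hIcard⟩ := hW.large_of_ssubset A (hA.ssubset_of_ne hAW)
  have h1 := weight_add_le hA hcl
  have h2 : cut G A (W \ A) = 0 := (cut_eq_zero_iff G).2 fun x hx y hy hxy =>
    (mem_sdiff.1 hy).2 (hcl x hx y (mem_sdiff.1 hy).1 hxy)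
  have h3 := cut_sdiff_right G hA A
  obtain ⟨J, hJ, hJind, hJcard⟩ := hW.large_of_ssubset (W \ A) (sdiff_ssubset hA hne)
  refine hW.notLarge ⟨I ∪ J, union_subset (hI.trans hA) (hJ.trans sdiff_subset),
    hIind.union hJind fun x hx y hy hxy => (cut_eq_zero_iff G).1 h2 x (hI hx) y (hJ hy) hxy, ?_⟩
  have hd : Disjoint I J := disjoint_of_subset_left hI (disjoint_of_subset_right hJ disjoint_sdiff)
  rw [card_union_of_disjoint hd]
  have h4 := cut_self_add G hA
  have h5 := card_sdiff_add_card_eq_card hA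
  omega

end IsMinimalBad

end Potential

section Degree

open Finset

variable {V : Type} [DecidableEq V] {G : SimpleGraph V} [DecidableRel G.Adj]

lemma IsDifficultSet.cut_self (hG : ¬ HasTriangleAdjC4 G) {C : Finset V}
    (hC : IsDifficultSet G C) : #C = 3 ∧ cut G C C = 6 ∨ #C = 6 ∧ cut G C C = 14 :=
  hC.imp (fun h => ⟨h.card, h.cut_self⟩) (fun h => ⟨h.card, h.cut_self hG⟩)

lemma cut_difficultComp {C S W : Finset V} (hS : S ⊆ W) (hC : C ∈ difficultComps G (W \ S)) :
    cut G C (W \ C) = cut G C S := by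
  obtain ⟨h1, -, h3⟩ := mem_difficultComps.1 hC
  have h4 : S ⊆ W \ C := fun x hx =>
    mem_sdiff.2 ⟨hS hx, fun hxC => (mem_sdiff.1 (h1 hxC)).2 hx⟩
  have h5 : cut G C ((W \ C) \ S) = 0 := (cut_eq_zero_iff G).2 fun x hx y hy hxy => by
    simp only [mem_sdiff] at hy
    exact hy.1.2 (h3 x hx y (mem_sdiff.2 ⟨hy.1.1, hy.2⟩) hxy)
  rw [cut_sdiff_right G h4, h5, add_zero]

lemma mul_card_difficultComps_le {S W : Finset V} {k : ℕ}
    (h : ∀ C ∈ difficultComps G (W \ S), k ≤ cut G C S) :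
    #(difficultComps G (W \ S)) * k ≤ cut G S (W \ S) := by
  have hd : (difficultComps G (W \ S) : Set (Finset V)).PairwiseDisjoint id := by
    intro C hC C' hC' hne
    obtain ⟨h1, h2, h3⟩ := mem_difficultComps.1 hC
    obtain ⟨h1', h2', h3'⟩ := mem_difficultComps.1 hC'
    exact disjoint_left.2 fun x hx hx' => hne (h2.eq_of_isClosedIn h2' h1 h1' h3 h3' hx hx')
  calc
    _ ≤ ∑ C ∈ difficultComps G (W \ S), cut G C S := by
        rw [← smul_eq_mul]
        exact card_nsmul_le_sum _ _ _ h
    _ = cut G ((difficultComps G (W \ S)).biUnion id) S := (sum_biUnion hd).symm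
    _ ≤ cut G (W \ S) S :=
        cut_mono G (biUnion_subset.2 fun C hC => (mem_difficultComps.1 hC).1) subset_rfl
    _ = _ := cut_comm G _ _

lemma cut_neighbors_self_le (hG : ¬ HasTriangleAdjC4 G) (v : V) (W : Finset V) :
    cut G {b ∈ W | G.Adj v b} {b ∈ W | G.Adj v b} ≤ #{b ∈ W | G.Adj v b} := by
  refine (cut_le_card_mul (k := 1) fun a ha => cut_le_one G ?_).trans_eq (mul_one _)
  intro x hx x' hx' y hy y' hy' h h'
  simp only [mem_singleton, mem_filter] at *
  subst hx hx'
  exact ⟨rfl, eq_of_adj_triangles hG ha.2 hy.2 h hy'.2 h'⟩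

namespace IsMinimalBad

variable {W : Finset V}

lemma not_isDifficultSet (hG : ¬ HasTriangleAdjC4 G) (hW : IsMinimalBad G W) :
    ¬ IsDifficultSet G W := by
  intro hD
  obtain ⟨I, hI, hIind, hIcard⟩ := hD.exists_indepSet hG (B := ∅) (by simp)
  have h1 := hD.cut_self hG
  have hmem : W ∈ difficultComps G W :=
    mem_difficultComps.2 ⟨subset_rfl, hD, fun x _ y hy _ => hy⟩
  have h2 : (if #W = 3 then 2 else 1) ≤ weight G W :=
    single_le_sum (f := fun C : Finset V => if #C = 3 then 2 else 1) (fun _ _ => Nat.zero_le _) hmem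
  refine hW.notLarge ⟨I, hI.trans sdiff_subset, hIind, ?_⟩
  split_ifs at h2 <;> omega

lemma cut_difficult_pos (hG : ¬ HasTriangleAdjC4 G) (hW : IsMinimalBad G W) {C : Finset V}
    (hCW : C ⊆ W) (hC : IsDifficultSet G C) : 1 ≤ cut G C (W \ C) := by
  by_contra h
  have h0 := (cut_eq_zero_iff G).1 (Nat.lt_one_iff.1 (not_le.1 h))
  refine hW.not_isDifficultSet hG (hW.eq_of_isClosedIn hCW hC.nonempty ?_ ▸ hC)
  intro x hx y hy hxy
  by_contra hyC
  exact h0 x hx y (mem_sdiff.2 ⟨hy, hyC⟩) hxy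

/-- In a minimal bad set at least three edges leave every triangle and every 2-chain. -/
lemma three_le_cut (hG : ¬ HasTriangleAdjC4 G) (hW : IsMinimalBad G W) {C : Finset V}
    (hCW : C ⊆ W) (hC : IsDifficultSet G C) : 3 ≤ cut G C (W \ C) := by
  by_contra! hlt
  have hpos := hW.cut_difficult_pos hG hCW hC
  set B := {v ∈ C | cut G {v} (W \ C) ≠ 0}
  have hBcard : #B ≤ 2 := by
    have h1 : #B * 1 ≤ cut G B (W \ C) :=
      card_mul_le_cut fun a ha => Nat.one_le_iff_ne_zero.2 (mem_filter.1 ha).2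
    have hBC : B ⊆ C := filter_subset _ _
    have h2 := cut_mono G hBC (subset_refl (W \ C))
    omega
  obtain ⟨I, hI, hIind, hIcard⟩ := hC.exists_indepSet hG hBcard
  have hred := hW.reduction hCW hC.nonempty (hI.trans sdiff_subset) hIind (by
    intro x hx y hy hxy
    by_contra hyC
    have hxB := mem_sdiff.1 (hI hx)
    refine hxB.2 (mem_filter.2 ⟨hxB.1, fun h => ?_⟩)
    exact (cut_eq_zero_iff G).1 h x (mem_singleton_self x) y (mem_sdiff.2 ⟨hy, hyC⟩) hxy)
  have hself := hC.cut_self hG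
  have hsplit := cut_sdiff_right G hCW C
  have hcomp : ∀ D ∈ difficultComps G (W \ C), 1 ≤ cut G D C := fun D hD => by
    rw [← cut_difficultComp hCW hD]
    exact hW.cut_difficult_pos hG ((mem_difficultComps.1 hD).1.trans sdiff_subset)
      (mem_difficultComps.1 hD).2.1
  have hcount := mul_card_difficultComps_le hcomp
  have hweight := weight_le (G := G) (W \ C)
  have hC3 : #C = 3 := by omega
  have hcut : cut G C (W \ C) = 1 := by omega
  by_cases hD : ∃ D ∈ difficultComps G (W \ C), #D = 3
  · obtain ⟨D, hD, hD3⟩ := hD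
    obtain ⟨h1, h2, h3⟩ := mem_difficultComps.1 hD
    have hDC : D ⊆ W \ C := h1
    have hd : Disjoint C D := disjoint_of_subset_right h1 disjoint_sdiff
    have h4 := hcomp D hD
    rw [cut_comm] at h4
    have h5 := cut_sdiff_right G hDC C
    have h6 : cut G C ((W \ C) \ D) = 0 := by omega
    have hch : IsChain G (C ∪ D) := by
      refine ⟨C, D, hC.isTriangle hC3, h2.isTriangle hD3, hd, ?_, rfl⟩
      by_contra! hno
      have := (cut_eq_zero_iff G).2 hno
      omega
    have hcl : IsClosedIn G (C ∪ D) W := by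
      intro x hx y hy hxy
      by_contra hyn
      rw [mem_union, not_or] at hyn
      rcases mem_union.1 hx with hx | hx
      · exact (cut_eq_zero_iff G).1 h6 x hx y
          (mem_sdiff.2 ⟨mem_sdiff.2 ⟨hy, hyn.1⟩, hyn.2⟩) hxy
      · exact hyn.2 (h3 x hx y (mem_sdiff.2 ⟨hy, hyn.1⟩) hxy)
    have heq := hW.eq_of_isClosedIn (union_subset hCW (h1.trans sdiff_subset))
      (hC.nonempty.mono subset_union_left) hcl
    exact hW.not_isDifficultSet hG (heq ▸ Or.inr hch)
  · push Not at hD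
    have := weight_le_card hD
    omega

lemma three_le_cut_difficultComp (hG : ¬ HasTriangleAdjC4 G) (hW : IsMinimalBad G W)
    {C S : Finset V} (hS : S ⊆ W) (hC : C ∈ difficultComps G (W \ S)) : 3 ≤ cut G C S := by
  rw [← cut_difficultComp hS hC]
  exact hW.three_le_cut hG ((mem_difficultComps.1 hC).1.trans sdiff_subset)
    (mem_difficultComps.1 hC).2.1

lemma degree_le_four (hG : ¬ HasTriangleAdjC4 G) (hW : IsMinimalBad G W) {v : V} (hv : v ∈ W) :
    cut G {v} W ≤ 4 := by
  by_contra! hdeg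
  have hS : {v} ⊆ W := singleton_subset_iff.2 hv
  have hred := hW.reduction hS (singleton_nonempty v) (empty_subset _)
    (fun x hx => absurd hx (notMem_empty x)) (fun x hx => absurd hx (notMem_empty x))
  have hempty : difficultComps G (W \ {v}) = ∅ := by
    refine eq_empty_of_forall_notMem fun C hC => ?_
    have h1 := hW.three_le_cut_difficultComp hG hS hC
    obtain ⟨h2, h3, -⟩ := mem_difficultComps.1 hC
    have h4 := cut_vertex_difficult_le_two hG h3
      (v := v) (fun h => (mem_sdiff.1 (h2 h)).2 (mem_singleton_self v))
    rw [cut_comm] at h1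
    omega
  have hweight := weight_le (G := G) (W \ {v})
  rw [hempty, card_empty] at hweight
  rw [cut_self_singleton, card_empty, card_singleton] at hred
  omega

/-- The inequalities obtained by deleting a closed neighbourhood. -/
lemma closedNeighborhood (hW : IsMinimalBad G W) {v : V} (hv : v ∈ W) {N : Finset V}
    (hN : N = {b ∈ W | G.Adj v b}) :
    insert v N ⊆ W ∧ #N = cut G {v} W ∧
    68 + 6 * cut G N W < 30 + 30 * #N + 3 * cut G N N + 2 * weight G (W \ insert v N) ∧
    cut G (insert v N) (W \ insert v N) + #N + cut G N N = cut G N W := by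
  have hNW : N ⊆ W := hN ▸ filter_subset _ _
  have hS : insert v N ⊆ W := insert_subset hv hNW
  have hvN : v ∉ N := by simp [hN]
  have hd : Disjoint {v} N := by simpa using hvN
  have hdeg : #N = cut G {v} W := by rw [cut_singleton, hN]
  have hdeg' : cut G {v} N = #N := by
    rw [cut_singleton, filter_true_of_mem]
    intro x hx
    rw [hN] at hx
    exact (mem_filter.1 hx).2
  have hred := hW.reduction (I := {v}) hS (insert_nonempty v N) (by simp)
    (fun x hx y hy => by
      rw [mem_singleton.1 hx, mem_singleton.1 hy]
      exact G.irrefl)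
    (fun x hx y hy hxy => by
      rw [mem_singleton.1 hx] at hxy
      rw [hN]
      exact mem_insert_of_mem (mem_filter.2 ⟨hy, hxy⟩))
  have h1 : cut G (insert v N) W = #N + cut G N W := by
    rw [insert_eq, cut_union_left G hd, hdeg]
  have h2 : cut G (insert v N) (insert v N) = 2 * #N + cut G N N := by
    rw [insert_eq, cut_union_left G hd, cut_union_right G hd, cut_union_right G hd,
      cut_self_singleton, cut_comm G N {v}, hdeg']
    ring
  have h3 := cut_sdiff_right G hS (insert v N)
  rw [card_insert_of_notMem hvN, card_singleton] at hred
  refine ⟨hS, hdeg, ?_, ?_⟩ <;> omega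

lemma two_le_degree (hG : ¬ HasTriangleAdjC4 G) (hW : IsMinimalBad G W) {v : V} (hv : v ∈ W) :
    2 ≤ cut G {v} W := by
  by_contra! hdeg
  obtain ⟨hS, h1, h2, h3⟩ := hW.closedNeighborhood hv rfl
  have h4 := cut_neighbors_self_le hG v W
  obtain ⟨k, hk⟩ := even_cut_self G {b ∈ W | G.Adj v b}
  have h5 := mul_card_difficultComps_le fun C hC => hW.three_le_cut_difficultComp hG hS hC
  have h6 := weight_le (G := G) (W \ insert v {b ∈ W | G.Adj v b})
  omega

lemma three_le_degree (hG : ¬ HasTriangleAdjC4 G) (hW : IsMinimalBad G W) {v : V} (hv : v ∈ W) :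
    3 ≤ cut G {v} W := by
  by_contra! hdeg
  have hdeg2 := hW.two_le_degree hG hv
  obtain ⟨N, hN⟩ : ∃ N, N = {b ∈ W | G.Adj v b} := ⟨_, rfl⟩
  obtain ⟨hS, h1, h2, h3⟩ := hW.closedNeighborhood hv hN
  have h4 := cut_neighbors_self_le hG v W
  rw [← hN] at h4
  obtain ⟨k, hk⟩ := even_cut_self G N
  have h5 := mul_card_difficultComps_le fun C hC => hW.three_le_cut_difficultComp hG hS hC
  have h6 := weight_le (G := G) (W \ insert v N)
  have h7 : #N * 2 ≤ cut G N W :=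
    card_mul_le_cut fun a ha => hW.two_le_degree hG (hS (mem_insert_of_mem ha))
  obtain ⟨a, ha, b, hb, hab⟩ : ∃ a ∈ N, ∃ b ∈ N, G.Adj a b := by
    by_contra! hno
    have := (cut_eq_zero_iff G).2 hno
    omega
  have hNab : N = {a, b} := by
    refine (eq_of_subset_of_card_le ?_ ?_).symm
    · simp [insert_subset_iff, ha, hb]
    · rw [card_pair hab.ne]
      omega
  have hadj : ∀ x ∈ N, G.Adj v x := fun x hx => by
    rw [hN] at hx
    exact (mem_filter.1 hx).2
  have hT : IsTriangle G (insert v N) :=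
    ⟨v, a, b, hadj a ha, hab, hadj b hb, by rw [hNab]⟩
  have := hW.three_le_cut hG hS (.inl hT)
  omega

lemma degree_eq_three_of_adj (hG : ¬ HasTriangleAdjC4 G) (hW : IsMinimalBad G W) {v x : V}
    (hv : v ∈ W) (hdeg : cut G {v} W = 3) (hx : x ∈ W) (hvx : G.Adj v x) :
    cut G {x} W = 3 := by
  obtain ⟨N, hN⟩ : ∃ N, N = {b ∈ W | G.Adj v b} := ⟨_, rfl⟩
  obtain ⟨hS, h1, h2, h3⟩ := hW.closedNeighborhood hv hN
  have h4 := cut_neighbors_self_le hG v W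
  rw [← hN] at h4
  obtain ⟨k, hk⟩ := even_cut_self G N
  have h5 := mul_card_difficultComps_le fun C hC => hW.three_le_cut_difficultComp hG hS hC
  have h6 := weight_le (G := G) (W \ insert v N)
  have hxN : x ∈ N := hN ▸ mem_filter.2 ⟨hx, hvx⟩
  have hx3 := hW.three_le_degree hG hx
  have h7 : #(N.erase x) * 3 ≤ cut G (N.erase x) W :=
    card_mul_le_cut fun a ha => hW.three_le_degree hG (hS (mem_insert_of_mem (mem_of_mem_erase ha)))
  rw [card_erase_of_mem hxN] at h7
  have h8 : cut G N W = cut G {x} W + cut G (N.erase x) W := by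
    conv_lhs => rw [← insert_erase hxN, insert_eq, cut_union_left G (by simp)]
  by_contra hne
  have hY : cut G N N = 2 := by omega
  obtain ⟨a, ha, b, hb, hab⟩ : ∃ a ∈ N, ∃ b ∈ N, G.Adj a b := by
    by_contra! hno
    have := (cut_eq_zero_iff G).2 hno
    omega
  have hadj : ∀ x ∈ N, G.Adj v x := fun x hx => by
    rw [hN] at hx
    exact (mem_filter.1 hx).2
  have hT : IsTriangle G {v, a, b} := ⟨v, a, b, hadj a ha, hab, hadj b hb, rfl⟩
  have hTS : {v, a, b} ⊆ insert v N := by simp [insert_subset_iff, ha, hb]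
  have hno3 : ∀ C ∈ difficultComps G (W \ insert v N), #C ≠ 3 := by
    intro C hC hC3
    obtain ⟨hCW, hCd, -⟩ := mem_difficultComps.1 hC
    have hCT := hCd.isTriangle hC3
    have hd : Disjoint (insert v N) C := disjoint_of_subset_right hCW disjoint_sdiff
    have h9 := hW.three_le_cut_difficultComp hG hS hC
    rw [cut_sdiff_right G hTS, cut_comm G C {v, a, b}, cut_comm G C (insert v N \ _)] at h9
    have h10 := cut_triangles_le_one hG hT hCT (disjoint_of_subset_left hTS hd)
    have h11 : cut G (insert v N \ {v, a, b}) C ≤ #(insert v N \ {v, a, b}) * 1 :=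
      cut_le_card_mul fun y hy => cut_vertex_triangle_le_one hG hCT
        (disjoint_left.1 hd (mem_sdiff.1 hy).1)
    have h12 := card_sdiff_add_card_eq_card hTS
    have h13 : #(insert v N) ≤ #N + 1 := card_insert_le _ _
    rw [hT.card] at h12
    omega
  have := weight_le_card hno3
  omega

lemma exists_degree_ne_four (hG : ¬ HasTriangleAdjC4 G) (hW : IsMinimalBad G W)
    (hne : W.Nonempty) : ∃ v ∈ W, cut G {v} W ≠ 4 := by
  by_contra! hreg
  obtain ⟨v, hv⟩ := hne
  obtain ⟨N, hN⟩ : ∃ N, N = {b ∈ W | G.Adj v b} := ⟨_, rfl⟩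
  obtain ⟨hS, h1, h2, h3⟩ := hW.closedNeighborhood hv hN
  have h4 := cut_neighbors_self_le hG v W
  rw [← hN] at h4
  rw [hreg v hv] at h1
  obtain ⟨k, hk⟩ := even_cut_self G N
  have hsix : ∀ C ∈ difficultComps G (W \ insert v N), 6 ≤ cut G C (insert v N) := by
    intro C hC
    obtain ⟨hCW, hCd, -⟩ := mem_difficultComps.1 hC
    have hCW' := hCW.trans sdiff_subset
    have h5 : #C * 4 ≤ cut G C W := card_mul_le_cut fun x hx => (hreg x (hCW' hx)).ge
    rw [← cut_difficultComp hS hC]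
    have h6 := cut_sdiff_right G hCW' C
    have h7 := hCd.cut_self hG
    omega
  have h5 := mul_card_difficultComps_le hsix
  have h7 : #N * 4 ≤ cut G N W :=
    card_mul_le_cut fun a ha => (hreg a (hS (mem_insert_of_mem ha))).ge
  have h7' : cut G N W ≤ #N * 4 :=
    cut_le_card_mul fun a ha => (hreg a (hS (mem_insert_of_mem ha))).le
  have hno3 : ∀ C ∈ difficultComps G (W \ insert v N), #C ≠ 3 := by
    intro C hC hC3
    obtain ⟨hCW, hCd, -⟩ := mem_difficultComps.1 hC
    have hd : Disjoint (insert v N) C := disjoint_of_subset_right hCW disjoint_sdiff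
    have h8 := hsix C hC
    rw [cut_comm, insert_eq, cut_union_left G (by simp [hN])] at h8
    have h9 : cut G {v} C = 0 := (cut_eq_zero_iff G).2 fun x hx y hy hxy => by
      rw [mem_singleton.1 hx] at hxy
      refine disjoint_right.1 hd hy (mem_insert_of_mem ?_)
      rw [hN]
      exact mem_filter.2 ⟨(mem_sdiff.1 (hCW hy)).1, hxy⟩
    have h10 : cut G N C ≤ #N * 1 := cut_le_card_mul fun y hy =>
      cut_vertex_triangle_le_one hG (hCd.isTriangle hC3)
        (disjoint_left.1 hd (mem_insert_of_mem hy))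
    omega
  have := weight_le_card hno3
  omega

lemma nonempty (hW : IsMinimalBad G W) : W.Nonempty := by
  by_contra h
  rw [not_nonempty_iff_eq_empty] at h
  exact hW.notLarge ⟨∅, empty_subset _, fun x hx => absurd hx (notMem_empty x), by simp [h]⟩

/-- A minimal bad set induces a cubic graph. -/
lemma degree_eq_three (hG : ¬ HasTriangleAdjC4 G) (hW : IsMinimalBad G W) {v : V} (hv : v ∈ W) :
    cut G {v} W = 3 := by
  obtain ⟨u, hu, hu4⟩ := hW.exists_degree_ne_four hG hW.nonempty
  have h3 := hW.three_le_degree hG hu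
  have h4 := hW.degree_le_four hG hu
  have heq : {x ∈ W | cut G {x} W = 3} = W := by
    refine hW.eq_of_isClosedIn (filter_subset _ _) ⟨u, mem_filter.2 ⟨hu, by omega⟩⟩ ?_
    intro x hx y hy hxy
    rw [mem_filter] at hx ⊢
    exact ⟨hy, hW.degree_eq_three_of_adj hG hx.1 hx.2 hy hxy⟩
  rw [← heq] at hv
  exact (mem_filter.1 hv).2

end IsMinimalBad

end Degree

section Cubic

open Finset

variable {V : Type} [DecidableEq V] {G : SimpleGraph V} [DecidableRel G.Adj]

/-- In a diamond-free graph, two triangles through a vertex of degree three coincide. -/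
lemma IsTriangle.eq_of_mem (hG : ¬ HasTriangleAdjC4 G) {T T' W : Finset V} (hT : IsTriangle G T)
    (hT' : IsTriangle G T') (hTW : T ⊆ W) (hTW' : T' ⊆ W) {x : V} (hx : x ∈ T) (hx' : x ∈ T')
    (hdeg : cut G {x} W = 3) : T = T' := by
  have hsub : T.erase x ∪ T'.erase x ⊆ {b ∈ W | G.Adj x b} := by
    intro y hy
    rcases mem_union.1 hy with hy | hy <;> obtain ⟨h1, h2⟩ := mem_erase.1 hy
    · exact mem_filter.2 ⟨hTW h2, hT.adj hx h2 h1.symm⟩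
    · exact mem_filter.2 ⟨hTW' h2, hT'.adj hx' h2 h1.symm⟩
  have h1 := card_le_card hsub
  rw [← cut_singleton, hdeg] at h1
  have h2 := card_union_add_card_inter (T.erase x) (T'.erase x)
  rw [card_erase_of_mem hx, card_erase_of_mem hx', hT.card, hT'.card] at h2
  obtain ⟨y, hy⟩ : (T.erase x ∩ T'.erase x).Nonempty := card_pos.1 (by omega)
  simp only [mem_inter, mem_erase] at hy
  obtain ⟨⟨hyx, hyT⟩, -, hyT'⟩ := hy
  obtain ⟨z, hz, hzx, hzy⟩ := hT'.exists_third x y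
  refine eq_of_subset_of_card_le (fun t ht => ?_) (by rw [hT.card, hT'.card])
  by_cases htx : t = x
  · exact htx ▸ hx'
  by_cases hty : t = y
  · exact hty ▸ hyT'
  rw [eq_of_adj_triangles hG (hT.adj hx hyT hyx.symm) (hT.adj hx ht (Ne.symm htx))
    (hT.adj hyT ht (Ne.symm hty)) (hT'.adj hx' hz hzx.symm) (hT'.adj hyT' hz hzy.symm)]
  exact hz

namespace IsMinimalBad

variable {W : Finset V}

/-- Every proper induced subgraph of a minimal bad set is 2-degenerate, hence 3-colourable. -/
lemma exists_coloring (hG : ¬ HasTriangleAdjC4 G) (hW : IsMinimalBad G W) (T : Finset V)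
    (hT : T ⊂ W) : ∃ c : V → Fin 3, ∀ x ∈ T, ∀ y ∈ T, G.Adj x y → c x ≠ c y := by
  induction T using Finset.strongInduction with
  | H T ih =>
    rcases T.eq_empty_or_nonempty with rfl | hne
    · exact ⟨fun _ => 0, fun x hx => absurd hx (notMem_empty x)⟩
    obtain ⟨x, hx, y, hy, hxy, hyT⟩ : ∃ x ∈ T, ∃ y ∈ W, G.Adj x y ∧ y ∉ T := by
      by_contra! hcl
      exact hT.ne (hW.eq_of_isClosedIn hT.subset hne hcl)
    obtain ⟨c, hc⟩ := ih (T.erase x) (erase_ssubset hx) ((erase_subset x T).trans_ssubset hT)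
    have h1 := cut_sdiff_right G hT.subset {x}
    have h2 : cut G {x} (W \ T) ≠ 0 := fun h =>
      (cut_eq_zero_iff G).1 h x (mem_singleton_self x) y (mem_sdiff.2 ⟨hy, hyT⟩) hxy
    rw [hW.degree_eq_three hG (hT.subset hx), cut_singleton G x T] at h1
    have h3 : #(image c {b ∈ T | G.Adj x b}) < #(univ : Finset (Fin 3)) := by
      refine card_image_le.trans_lt ?_
      rw [card_univ, Fintype.card_fin]
      omega
    obtain ⟨k, -, hk⟩ := exists_mem_notMem_of_card_lt_card h3
    have hk' : ∀ b ∈ T, G.Adj x b → c b ≠ k := fun b hb hxb h =>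
      hk (mem_image.2 ⟨b, mem_filter.2 ⟨hb, hxb⟩, h⟩)
    refine ⟨Function.update c x k, fun a ha b hb hab => ?_⟩
    by_cases hax : a = x
    · subst hax
      simpa [Function.update_of_ne hab.ne'] using (hk' b hb hab).symm
    by_cases hbx : b = x
    · subst hbx
      simpa [Function.update_of_ne hab.ne] using hk' a ha hab.symm
    simpa [Function.update_of_ne hax, Function.update_of_ne hbx] using
      hc a (mem_erase.2 ⟨hax, ha⟩) b (mem_erase.2 ⟨hbx, hb⟩) hab

lemma exists_indepSet_of_ssubset (hG : ¬ HasTriangleAdjC4 G) (hW : IsMinimalBad G W)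
    {T : Finset V} (hT : T ⊂ W) : ∃ I ⊆ T, IsIndepSet G I ∧ #T ≤ 3 * #I := by
  obtain ⟨c, hc⟩ := hW.exists_coloring hG T hT
  have h1 : #T = ∑ i : Fin 3, #{x ∈ T | c x = i} :=
    card_eq_sum_card_fiberwise fun _ _ => mem_univ _
  obtain ⟨i, hi⟩ : ∃ i, #T ≤ 3 * #{x ∈ T | c x = i} := by
    by_contra! hlt
    have := hlt 0
    have := hlt 1
    have := hlt 2
    rw [Fin.sum_univ_three] at h1
    omega
  refine ⟨_, filter_subset _ _, fun x hx y hy hxy => ?_, hi⟩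
  rw [mem_filter] at hx hy
  exact hc x hx.1 y hy.1 hxy (hx.2.trans hy.2.symm)

lemma cut_self (hG : ¬ HasTriangleAdjC4 G) (hW : IsMinimalBad G W) : cut G W W = #W * 3 :=
  le_antisymm (cut_le_card_mul fun _ ha => (hW.degree_eq_three hG ha).le)
    (card_mul_le_cut fun _ ha => (hW.degree_eq_three hG ha).ge)

lemma card_indepSet_lt (hG : ¬ HasTriangleAdjC4 G) (hW : IsMinimalBad G W) {I : Finset V}
    (hI : I ⊆ W) (hIind : IsIndepSet G I) : 68 * #I < 21 * #W := by
  by_contra hcon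
  have := hW.cut_self hG
  exact hW.notLarge ⟨I, hI, hIind, by omega⟩

lemma exists_nonadj_neighbor (hG : ¬ HasTriangleAdjC4 G) (hW : IsMinimalBad G W) {u w : V}
    (hw : w ∈ W) (huw : G.Adj u w) : ∃ u' ∈ W, u' ≠ u ∧ G.Adj w u' ∧ ¬ G.Adj u u' := by
  by_contra! hcon
  have h1 := hW.degree_eq_three hG hw
  rw [cut_singleton] at h1
  have h2 : 1 < #({b ∈ W | G.Adj w b}.erase u) := by
    have := pred_card_le_card_erase (s := {b ∈ W | G.Adj w b}) (a := u)
    omega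
  obtain ⟨a, ha, b, hb, hab⟩ := one_lt_card.1 h2
  simp only [mem_erase, mem_filter] at ha hb
  exact hab (eq_of_adj_triangles hG huw (hcon a ha.2.1 ha.1 ha.2.2) ha.2.2
    (hcon b hb.2.1 hb.1 hb.2.2) hb.2.2)

lemma card_eq_ten (hG : ¬ HasTriangleAdjC4 G) (hW : IsMinimalBad G W) : #W = 10 := by
  obtain ⟨v, hv⟩ := hW.nonempty
  obtain ⟨I, hI, hIind, hIcard⟩ := hW.exists_indepSet_of_ssubset hG (erase_ssubset hv)
  rw [card_erase_of_mem hv] at hIcard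
  have h1 := hW.card_indepSet_lt hG (hI.trans (erase_subset v W)) hIind
  obtain ⟨k, hk⟩ := even_cut_self G W
  rw [hW.cut_self hG] at hk
  have h2 := hW.degree_eq_three hG hv
  rw [cut_singleton] at h2
  obtain ⟨w, hw⟩ : {b ∈ W | G.Adj v b}.Nonempty := card_pos.1 (by omega)
  rw [mem_filter] at hw
  obtain ⟨u, hu, huv, -, hvu⟩ := hW.exists_nonadj_neighbor hG hw.1 hw.2
  have h3 := hW.card_indepSet_lt hG (I := {v, u}) (by simp [insert_subset_iff, hu, hv])
    (indepSet_pair hvu)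
  rw [card_pair huv.symm] at h3
  have h4 : #I ≤ 4 := by omega
  interval_cases #I <;> omega

/-- The vertices at distance at least two from both `u` and `u'` form a triangle. -/
lemma exists_far_triangle (hG : ¬ HasTriangleAdjC4 G) (hW : IsMinimalBad G W) {u u' w : V}
    (hu : u ∈ W) (hu' : u' ∈ W) (hw : w ∈ W) (hne : u ≠ u') (hadj : ¬ G.Adj u u')
    (huw : G.Adj u w) (huw' : G.Adj u' w) :
    ∃ T ⊆ W, IsTriangle G T ∧ ∀ r ∈ W, r ≠ u → r ≠ u' → ¬ G.Adj u r → ¬ G.Adj u' r → r ∈ T := by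
  have hcard : ∀ x ∈ W, #(insert x {b ∈ W | G.Adj x b}) ≤ 4 := fun x hx => by
    have := card_insert_le x {b ∈ W | G.Adj x b}
    rw [← cut_singleton, hW.degree_eq_three hG hx] at this
    exact this
  have h1 := card_union_add_card_inter (insert u {b ∈ W | G.Adj u b})
    (insert u' {b ∈ W | G.Adj u' b})
  have h2 : 0 < #(insert u {b ∈ W | G.Adj u b} ∩ insert u' {b ∈ W | G.Adj u' b}) :=
    card_pos.2 ⟨w, by simp [hw, huw, huw']⟩
  have h3 := hcard u hu
  have h4 := hcard u' hu'
  obtain ⟨R, hR⟩ : ∃ R, R = W \ (insert u {b ∈ W | G.Adj u b} ∪ insert u' {b ∈ W | G.Adj u' b}) :=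
    ⟨_, rfl⟩
  have h5 := le_card_sdiff (insert u {b ∈ W | G.Adj u b} ∪ insert u' {b ∈ W | G.Adj u' b}) W
  rw [← hR, hW.card_eq_ten hG] at h5
  have hmem : ∀ r, r ∈ R ↔ r ∈ W ∧ r ≠ u ∧ r ≠ u' ∧ ¬ G.Adj u r ∧ ¬ G.Adj u' r := fun r => by
    rw [hR]
    simp only [mem_sdiff, mem_union, mem_insert, mem_filter]
    tauto
  have hclique : ∀ x ∈ R, ∀ y ∈ R, x ≠ y → G.Adj x y := by
    intro x hx y hy hxy
    by_contra hxy'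
    rw [hmem] at hx hy
    have hind : IsIndepSet G ({u, u'} ∪ {x, y}) := by
      refine (indepSet_pair hadj).union (indepSet_pair hxy') ?_
      simp only [mem_insert, mem_singleton]
      rintro a (rfl | rfl) b (rfl | rfl) <;> tauto
    have hd : Disjoint ({u, u'} : Finset V) {x, y} := by
      rw [disjoint_left]
      simp only [mem_insert, mem_singleton]
      rintro a (rfl | rfl) (h | h) <;> simp_all
    have h6 := hW.card_indepSet_lt hG (by
      simp [insert_subset_iff, hu, hu', hx.1, hy.1]) hind
    rw [card_union_of_disjoint hd, card_pair hne, card_pair hxy, hW.card_eq_ten hG] at h6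
    omega
  obtain ⟨a, b, c, ha, hb, hc, hab, hac, hbc⟩ := two_lt_card_iff.1 (show 2 < #R by omega)
  refine ⟨{a, b, c}, ?_, ⟨a, b, c, hclique a ha b hb hab, hclique b hb c hc hbc,
    hclique a ha c hc hac, rfl⟩, ?_⟩
  · have hRW : R ⊆ W := hR ▸ sdiff_subset
    simp [insert_subset_iff, hRW ha, hRW hb, hRW hc]
  · intro r hr h6 h7 h8 h9
    have hrR := (hmem r).2 ⟨hr, h6, h7, h8, h9⟩
    by_contra hrn
    simp only [mem_insert, mem_singleton, not_or] at hrn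
    exact hbc (eq_of_adj_triangles hG (hclique r hrR a ha hrn.1) (hclique r hrR b hb hrn.2.1)
      (hclique a ha b hb hab) (hclique r hrR c hc hrn.2.2) (hclique a ha c hc hac))

end IsMinimalBad

lemma not_isMinimalBad (hG : ¬ HasTriangleAdjC4 G) (W : Finset V) : ¬ IsMinimalBad G W := by
  intro hW
  have hnbr : ∀ v ∈ W, ∃ w ∈ W, G.Adj v w := fun v hv => by
    have h := hW.degree_eq_three hG hv
    rw [cut_singleton] at h
    obtain ⟨w, hw⟩ : {b ∈ W | G.Adj v b}.Nonempty := card_pos.1 (by omega)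
    exact ⟨w, mem_filter.1 hw⟩
  obtain ⟨T, hTW, hT⟩ : ∃ T ⊆ W, IsTriangle G T := by
    obtain ⟨u, hu⟩ := hW.nonempty
    obtain ⟨w, hw, huw⟩ := hnbr u hu
    obtain ⟨u', hu', hne, hwu', hadj⟩ := hW.exists_nonadj_neighbor hG hw huw
    obtain ⟨T, hTW, hT, -⟩ :=
      hW.exists_far_triangle hG hu hu' hw hne.symm hadj huw hwu'.symm
    exact ⟨T, hTW, hT⟩
  have hout : ∀ x ∈ T, ∃ x' ∈ W, x' ∉ T ∧ G.Adj x x' := by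
    intro x hx
    have h1 := cut_sdiff_right G hTW {x}
    have h2 : cut G {x} T ≤ #(T.erase x) := by
      rw [cut_singleton]
      refine card_le_card fun b hb => ?_
      rw [mem_filter] at hb
      exact mem_erase.2 ⟨hb.2.ne', hb.1⟩
    rw [card_erase_of_mem hx, hT.card] at h2
    rw [hW.degree_eq_three hG (hTW hx)] at h1
    by_contra! hno
    have h3 : cut G {x} (W \ T) = 0 := (cut_eq_zero_iff G).2 fun a ha b hb => by
      rw [mem_singleton.1 ha]
      exact hno b (mem_sdiff.1 hb).1 (mem_sdiff.1 hb).2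
    omega
  choose! f hfW hfT hf using hout
  have htri : ∀ x ∈ T, ∃ S ⊆ W, IsTriangle G S ∧ f x ∈ S := by
    intro x hx
    obtain ⟨y, hy, hyx, -⟩ := hT.exists_third x x
    obtain ⟨z, hz, hzx, hzy⟩ := hT.exists_third x y
    obtain ⟨h1, -, -⟩ := hT.pendants hG hy hz hzy.symm (hfT y hy) (hfT z hz) (hf y hy) (hf z hz)
    obtain ⟨h2, -, -⟩ := hT.pendants hG hy hx hyx (hfT y hy) (hfT x hx) (hf y hy) (hf x hx)
    obtain ⟨-, h3, h4⟩ := hT.pendants hG hz hx hzx (hfT z hz) (hfT x hx) (hf z hz) (hf x hx)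
    obtain ⟨S, hSW, hS, hmem⟩ := hW.exists_far_triangle hG (hTW hy) (hfW z hz) (hTW hz)
      (fun h => hfT z hz (h ▸ hy)) h1 (hT.adj hy hz hzy.symm) (hf z hz).symm
    exact ⟨S, hSW, hS, hmem (f x) (hfW x hx) (fun h => hfT x hx (h ▸ hy)) h3.symm h2 h4⟩
  choose! S hSW hS hfS using htri
  have hdisj : ∀ {A B : Finset V}, A ⊆ W → B ⊆ W → IsTriangle G A → IsTriangle G B → A ≠ B →
      Disjoint A B := fun hA hB hA' hB' hne => disjoint_left.2 fun v hvA hvB =>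
    hne (hA'.eq_of_mem hG hB' hA hB hvA hvB (hW.degree_eq_three hG (hA hvA)))
  have hpair : (T : Set V).PairwiseDisjoint S := by
    intro x hx y hy hxy
    refine hdisj (hSW x hx) (hSW y hy) (hS x hx) (hS y hy) fun h => ?_
    obtain ⟨-, h1, h2⟩ := hT.pendants hG hx hy hxy (hfT x hx) (hfT y hy) (hf x hx) (hf y hy)
    exact h2 ((hS y hy).adj (h ▸ hfS x hx) (hfS y hy) h1)
  have hd : Disjoint T (T.biUnion S) := (disjoint_biUnion_right _ _ _).2 fun x hx =>
    hdisj hTW (hSW x hx) hT (hS x hx) fun h => hfT x hx (by rw [h]; exact hfS x hx)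
  have h1 := card_le_card (union_subset hTW (biUnion_subset.2 hSW))
  rw [card_union_of_disjoint hd, card_biUnion hpair, sum_congr rfl fun x hx => (hS x hx).card,
    sum_const, hT.card, hW.card_eq_ten hG] at h1
  norm_num at h1

theorem hasLargeIndepSet (hG : ¬ HasTriangleAdjC4 G) (W : Finset V) : HasLargeIndepSet G W := by
  induction W using Finset.strongInduction with
  | H W ih =>
    by_contra hW
    exact not_isMinimalBad hG W ⟨hW, ih⟩

end Cubic

section Components

open Finset

variable {V : Type} [DecidableEq V] {G : SimpleGraph V}

lemma IsTriangle.nonempty_iso {T : Finset V} (hT : IsTriangle G T) :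
    Nonempty (SimpleGraph.induce (T : Set V) G ≃g (⊤ : SimpleGraph (Fin 3))) := by
  have e : T ≃ Fin 3 := T.equivFinOfCardEq hT.card
  refine ⟨⟨e, ?_⟩⟩
  intro a b
  simp only [SimpleGraph.top_adj, SimpleGraph.comap_adj, Function.Embedding.subtype_apply, ne_eq,
    EmbeddingLike.apply_eq_iff_eq]
  exact ⟨fun h => hT.adj a.2 b.2 fun h' => h (Subtype.ext h'), fun h h' => h.ne (congrArg _ h')⟩

lemma IsTriangle.exists_eq_of_mem {T : Finset V} (hT : IsTriangle G T) {x : V} (hx : x ∈ T) :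
    ∃ y z, T = {y, z, x} ∧ y ≠ z ∧ y ≠ x ∧ z ≠ x := by
  obtain ⟨y, hy, hyx, -⟩ := hT.exists_third x x
  obtain ⟨z, hz, hzx, hzy⟩ := hT.exists_third x y
  refine ⟨y, z, (eq_of_subset_of_card_le ?_ ?_).symm, hzy.symm, hyx, hzx⟩
  · simp [insert_subset_iff, hx, hy, hz]
  · rw [hT.card, card_eq_three.2 ⟨y, z, x, hzy.symm, hyx, hzx, rfl⟩]

lemma IsChain.nonempty_iso (hG : ¬ HasTriangleAdjC4 G) {C : Finset V} (hC : IsChain G C) :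
    Nonempty (SimpleGraph.induce (C : Set V) G ≃g chainGraph) := by
  have hcard := hC.card
  obtain ⟨A, B, hA, hB, hd, ⟨x, hx, y, hy, hxy⟩, rfl⟩ := hC
  obtain ⟨a, b, hAeq, hab, hax, hbx⟩ := hA.exists_eq_of_mem hx
  obtain ⟨c, d, hBeq, hcd, hcy, hdy⟩ := hB.exists_eq_of_mem hy
  have haA : a ∈ A := by simp [hAeq]
  have hbA : b ∈ A := by simp [hAeq]
  have hcB : c ∈ B := by simp [hBeq]
  have hdB : d ∈ B := by simp [hBeq]
  have hne : ∀ {x y}, x ∈ A → y ∈ B → x ≠ y := fun hx hy => disjoint_iff_ne.1 hd _ hx _ hy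
  have hno : ∀ p ∈ A, ∀ q ∈ B, p ≠ x ∨ q ≠ y → ¬ G.Adj p q := fun p hp q hq h hpq => by
    have := triangle_edges_unique hG hA hB hd hp hx hq hy hpq hxy
    tauto
  let f : Fin 6 → V := ![a, b, x, y, c, d]
  have hf : ∀ i, f i ∈ (↑(A ∪ B) : Set V) := by
    intro i
    fin_cases i <;> simp [f, haA, hbA, hcB, hdB, hx, hy]
  have hadj : ∀ i j, G.Adj (f i) (f j) ↔ chainGraph.Adj i j := by
    have h1 := hA.adj haA hbA hab
    have h2 := hA.adj haA hx hax
    have h3 := hA.adj hbA hx hbx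
    have h4 := hB.adj hcB hdB hcd
    have h5 := hB.adj hcB hy hcy
    have h6 := hB.adj hdB hy hdy
    have h7 := hno a haA y hy (.inl hax)
    have h8 := hno a haA c hcB (.inl hax)
    have h9 := hno a haA d hdB (.inl hax)
    have h10 := hno b hbA y hy (.inl hbx)
    have h11 := hno b hbA c hcB (.inl hbx)
    have h12 := hno b hbA d hdB (.inl hbx)
    have h13 := hno x hx c hcB (.inr hcy)
    have h14 := hno x hx d hdB (.inr hdy)
    intro i j
    fin_cases i <;> fin_cases j <;>
      simp [f, chainGraph, SimpleGraph.fromRel_adj, h1, h2, h3, h4, h5, h6, h7, h8, h9, h10, h11,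
        h12, h13, h14, h1.symm, h2.symm, h3.symm, h4.symm, h5.symm, h6.symm, hxy, hxy.symm,
        mt SimpleGraph.Adj.symm h7, mt SimpleGraph.Adj.symm h8, mt SimpleGraph.Adj.symm h9,
        mt SimpleGraph.Adj.symm h10, mt SimpleGraph.Adj.symm h11, mt SimpleGraph.Adj.symm h12,
        mt SimpleGraph.Adj.symm h13, mt SimpleGraph.Adj.symm h14]
  have hinj : Function.Injective fun i => (⟨f i, hf i⟩ : (↑(A ∪ B) : Set V)) := by
    intro i j hij
    have h1 := hne haA hy
    have h2 := hne haA hcB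
    have h3 := hne haA hdB
    have h4 := hne hbA hy
    have h5 := hne hbA hcB
    have h6 := hne hbA hdB
    have h7 := hne hx hy
    have h8 := hne hx hcB
    have h9 := hne hx hdB
    have h : f i = f j := congrArg Subtype.val hij
    clear hij
    revert h
    fin_cases i <;> fin_cases j <;>
      simp [f, hab, hax, hbx, hcd, hcy, hdy, h1, h2, h3, h4, h5, h6, h7, h8, h9, hab.symm, hax.symm,
        hbx.symm, hcd.symm, hcy.symm, hdy.symm, h1.symm, h2.symm, h3.symm, h4.symm, h5.symm,
        h6.symm, h7.symm, h8.symm, h9.symm]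
  have hbij : Function.Bijective fun i => (⟨f i, hf i⟩ : (↑(A ∪ B) : Set V)) := by
    rw [Fintype.bijective_iff_injective_and_card]
    refine ⟨hinj, ?_⟩
    simp only [Fintype.card_fin, coe_sort_coe, Fintype.card_coe, hcard]
  exact ⟨(⟨Equiv.ofBijective _ hbij, fun {i j} => hadj i j⟩ :
    chainGraph ≃g SimpleGraph.induce (↑(A ∪ B) : Set V) G).symm⟩

variable [Fintype V]

lemma supp_eq_of_mem_difficultComps {C : Finset V} (hC : C ∈ difficultComps G univ) {x : V}
    (hx : x ∈ C) : (G.connectedComponentMk x).supp = (C : Set V) := by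
  classical
  obtain ⟨-, hCd, hcl⟩ := mem_difficultComps.1 hC
  have hsub : C ⊆ univ.filter fun y => G.Reachable y x :=
    hCd.subset_of_isClosedIn (W := univ) (subset_univ C)
      (fun y hy z _ hyz => by
        simp only [mem_filter, mem_univ, true_and] at hy ⊢
        exact hyz.symm.reachable.trans hy) hx (by simp)
  ext y
  rw [SimpleGraph.ConnectedComponent.mem_supp_iff, SimpleGraph.ConnectedComponent.eq, mem_coe]
  refine ⟨fun h => ?_, fun h => by simpa using hsub h⟩
  obtain ⟨p⟩ := h.symm
  clear h hsub
  induction p with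
  | nil => exact hx
  | cons hadj p ih =>
    exact ih (hcl _ hx _ (mem_univ _) hadj)

lemma card_difficultComps_le_lambda (hG : ¬ HasTriangleAdjC4 G) :
    #(difficultComps G univ) ≤ lambda G := by
  have hex : ∀ C : difficultComps G univ, ∃ c : {c : G.ConnectedComponent // IsDifficult G c},
      c.1.supp = (C.1 : Set V) := by
    rintro ⟨C, hC⟩
    obtain ⟨-, hCd, -⟩ := mem_difficultComps.1 hC
    obtain ⟨x, hx⟩ := hCd.nonempty
    have hsupp := supp_eq_of_mem_difficultComps hC hx
    refine ⟨⟨G.connectedComponentMk x, ?_⟩, hsupp⟩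
    unfold IsDifficult
    rw [hsupp]
    exact hCd.imp (·.nonempty_iso) (·.nonempty_iso hG)
  choose g hg using hex
  have hinj : Function.Injective g := fun C C' h => by
    have h1 := hg C
    rw [h, hg C'] at h1
    exact Subtype.ext (coe_injective h1.symm)
  have := Nat.card_le_card_of_injective g hinj
  rwa [Nat.card_eq_fintype_card, Fintype.card_coe] at this

omit [DecidableEq V] in
lemma cut_univ_univ [DecidableRel G.Adj] : cut G univ univ = 2 * numEdges G := by
  rw [numEdges, Nat.card_eq_fintype_card, ← SimpleGraph.edgeFinset_card,
    ← G.sum_degrees_eq_twice_card_edges, cut_eq_sum]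
  refine sum_congr rfl fun v _ => ?_
  rw [cut_singleton, ← SimpleGraph.card_neighborFinset_eq_degree,
    SimpleGraph.neighborFinset_eq_filter]

omit [DecidableEq V] in
lemma card_le_indepNum {I : Finset V} (hI : IsIndepSet G I) : #I ≤ indepNum G :=
  le_csSup ⟨Fintype.card V, by rintro n ⟨s, -, rfl⟩; exact card_le_univ s⟩ ⟨I, hI, rfl⟩

end Components

/-- The technical theorem specialized to a = 19/34, b = 3/34. -/
theorem technical_theorem_specialized
    {V : Type} [Fintype V] (G : SimpleGraph V)
    (hG : ¬ HasTriangleAdjC4 G) :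
    (indepNum G : ℝ) ≥
      (Nat.card V : ℝ) -
        (19 * Nat.card V + 3 * numEdges G + 3 * lambda G) / 34 := by
  classical
  obtain ⟨I, -, hI, hcard⟩ := hasLargeIndepSet hG Finset.univ
  have h1 := card_le_indepNum hI
  have h2 := card_difficultComps_le_lambda hG
  have h3 := weight_le (G := G) Finset.univ
  rw [cut_univ_univ, Finset.card_univ, ← Nat.card_eq_fintype_card] at hcard
  have h4 : 15 * Nat.card V ≤ 34 * indepNum G + 3 * numEdges G + 3 * lambda G := by omega
  have h5 : (15 * Nat.card V : ℝ) ≤ 34 * indepNum G + 3 * numEdges G + 3 * lambda G := by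
    exact_mod_cast h4
  linarith

end Paper
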